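/- Assume that the string α[i2] ++ α[j1:j2] is distinct. Let J_0, …, J_{h−1} be a partition of {j1,…,j2} into nonempty consecutive intervals, where J_ℓ has left endpoint x_ℓ and right endpoint y_ℓ. For each ℓ define p_ℓ = L(α, I, prev(x_ℓ)), q_ℓ = min(i2, p_ℓ + |J_ℓ| − 1), y_ℓ' = min(y_ℓ, R(α, I, succ(q_ℓ))), and I_ℓ = (p_ℓ, q_ℓ, x_ℓ, y_ℓ'); assume x_ℓ ≤ y_ℓ' for every ℓ. Then BLDS(α, I) = max over 0 ≤ ℓ ≤ h−1 of [ (i2 − q_ℓ) + (x_ℓ − j1) + BLDS(α, I_ℓ) ]. -/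

import Mathlib

/-- The positions `P(I)` of the string `b = α[i1:i2] ++ α[j1:j2]`. -/
def PosSet (i1 i2 j1 j2 : ℕ) : Finset ℕ := Finset.Icc i1 i2 ∪ Finset.Icc j1 j2

/-- The substring of `b` from position `p` to position `q` (i.e. on the positions
of `P(I)` between `p` and `q`) is distinct. -/
def DistinctBtw {α : Type*} (a : ℕ → α) (i1 i2 j1 j2 p q : ℕ) : Prop :=
  ∀ u ∈ PosSet i1 i2 j1 j2 ∩ Finset.Icc p q, ∀ v ∈ PosSet i1 i2 j1 j2 ∩ Finset.Icc p q,
    a u = a v → u = v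

/-- The length of the substring of `b` from position `p` to position `q`. -/
def LenBtw (i1 i2 j1 j2 p q : ℕ) : ℕ := (PosSet i1 i2 j1 j2 ∩ Finset.Icc p q).card

open Classical in
/-- `LDS(b, X)`: the maximum length of a distinct substring of `b` whose right
endpoint lies in `X` (`0` if there is none). -/
noncomputable def LDSX {α : Type*} (a : ℕ → α) (i1 i2 j1 j2 : ℕ) (X : Finset ℕ) : ℕ :=
  ((PosSet i1 i2 j1 j2 ×ˢ (X ∩ PosSet i1 i2 j1 j2)).filter
      (fun pq => pq.1 ≤ pq.2 ∧ DistinctBtw a i1 i2 j1 j2 pq.1 pq.2)).sup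
    fun pq => LenBtw i1 i2 j1 j2 pq.1 pq.2

open Classical in
/-- `BLDS(α, I)`: the maximum length of a distinct substring of `b` that contains
position `i2` or position `j1`. -/
noncomputable def BLDS {α : Type*} (a : ℕ → α) (i1 i2 j1 j2 : ℕ) : ℕ :=
  ((PosSet i1 i2 j1 j2 ×ˢ PosSet i1 i2 j1 j2).filter
      (fun pq => pq.1 ≤ pq.2 ∧
        ((pq.1 ≤ i2 ∧ i2 ≤ pq.2) ∨ (pq.1 ≤ j1 ∧ j1 ≤ pq.2)) ∧
        DistinctBtw a i1 i2 j1 j2 pq.1 pq.2)).sup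
    fun pq => LenBtw i1 i2 j1 j2 pq.1 pq.2

/-- `L(α, I, k)`: the smallest position `p ∈ P(I)` such that the substring of `b`
from `p` to `k` is distinct. -/
noncomputable def Lfun {α : Type*} (a : ℕ → α) (i1 i2 j1 j2 k : ℕ) : ℕ :=
  sInf {p : ℕ | p ∈ PosSet i1 i2 j1 j2 ∧ p ≤ k ∧ DistinctBtw a i1 i2 j1 j2 p k}

/-- `R(α, I, k)`: the largest position `q ∈ P(I)` such that the substring of `b`
from `k` to `q` is distinct. -/
noncomputable def Rfun {α : Type*} (a : ℕ → α) (i1 i2 j1 j2 k : ℕ) : ℕ :=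
  sSup {q : ℕ | q ∈ PosSet i1 i2 j1 j2 ∧ k ≤ q ∧ DistinctBtw a i1 i2 j1 j2 k q}

/-- `prev(k)` for `k ∈ {j1,…,j2}`. -/
def prevP (i2 j1 k : ℕ) : ℕ := if k = j1 then i2 else k - 1

/-- `succ(k)` for `k ∈ {i1,…,i2}`. -/
def succP (i2 j1 k : ℕ) : ℕ := if k = i2 then j1 else k + 1


theorem mem_PosSet {i1 i2 j1 j2 u : ℕ} :
    u ∈ PosSet i1 i2 j1 j2 ↔ (i1 ≤ u ∧ u ≤ i2) ∨ (j1 ≤ u ∧ u ≤ j2) := by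
  simp [PosSet]

theorem distinctBtw_iff {α : Type*} {a : ℕ → α} {i1 i2 j1 j2 s t : ℕ} :
    DistinctBtw a i1 i2 j1 j2 s t ↔
      ∀ u v, ((i1 ≤ u ∧ u ≤ i2) ∨ (j1 ≤ u ∧ u ≤ j2)) → ((i1 ≤ v ∧ v ≤ i2) ∨ (j1 ≤ v ∧ v ≤ j2)) →
        s ≤ u → u < v → v ≤ t → a u ≠ a v := by
  simp only [DistinctBtw, Finset.mem_inter, mem_PosSet, Finset.mem_Icc]
  constructor
  · intro hd u v hu hv hsu huv hvt hauv
    exact huv.ne (hd u ⟨hu, hsu, by omega⟩ v ⟨hv, by omega, hvt⟩ hauv)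
  · intro hd u hu v hv hauv
    rcases lt_trichotomy u v with huv | huv | huv
    · exact absurd hauv (hd u v hu.1 hv.1 hu.2.1 huv hv.2.2)
    · exact huv
    · exact absurd hauv.symm (hd v u hv.1 hu.1 hv.2.1 huv hu.2.2)

theorem DistinctBtw.mono {α : Type*} {a : ℕ → α} {i1 i2 j1 j2 s t s' t' : ℕ}
    (hd : DistinctBtw a i1 i2 j1 j2 s t) (hs : s ≤ s') (ht : t' ≤ t) :
    DistinctBtw a i1 i2 j1 j2 s' t' := by
  rw [distinctBtw_iff] at hd ⊢
  exact fun u v hu hv hsu huv hvt => hd u v hu hv (hs.trans hsu) huv (hvt.trans ht)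

theorem lenBtw_cross {i1 i2 j1 j2 s t : ℕ} (hij : i2 < j1) (hs : i1 ≤ s) (hs' : s ≤ i2)
    (ht : j1 ≤ t) (ht' : t ≤ j2) :
    LenBtw i1 i2 j1 j2 s t = (i2 - s + 1) + (t - j1 + 1) := by
  have hset : PosSet i1 i2 j1 j2 ∩ Finset.Icc s t = Finset.Icc s i2 ∪ Finset.Icc j1 t := by
    ext u
    simp only [Finset.mem_inter, mem_PosSet, Finset.mem_union, Finset.mem_Icc]
    omega
  have hdisj : Disjoint (Finset.Icc s i2) (Finset.Icc j1 t) := by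
    rw [Finset.disjoint_left]
    intro u
    simp only [Finset.mem_Icc]
    omega
  rw [LenBtw, hset, Finset.card_union_of_disjoint hdisj, Nat.card_Icc, Nat.card_Icc]
  omega

theorem lenBtw_left {i1 i2 j1 j2 s t : ℕ} (hs : i1 ≤ s) (hst : s ≤ t)
    (ht : t ≤ i2) : LenBtw i1 i2 j1 j2 s t = t - s + 1 := by
  have hset : PosSet i1 i2 j1 j2 ∩ Finset.Icc s t = Finset.Icc s t := by
    ext u
    simp only [Finset.mem_inter, mem_PosSet, Finset.mem_Icc]
    omega
  rw [LenBtw, hset, Nat.card_Icc]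
  omega

theorem lenBtw_right {i1 i2 j1 j2 s t : ℕ} (hs : j1 ≤ s) (hst : s ≤ t)
    (ht : t ≤ j2) : LenBtw i1 i2 j1 j2 s t = t - s + 1 := by
  have hset : PosSet i1 i2 j1 j2 ∩ Finset.Icc s t = Finset.Icc s t := by
    ext u
    simp only [Finset.mem_inter, mem_PosSet, Finset.mem_Icc]
    omega
  rw [LenBtw, hset, Nat.card_Icc]
  omega

theorem lenBtw_le_BLDS {α : Type*} {a : ℕ → α} {i1 i2 j1 j2 s t : ℕ}
    (hs : s ∈ PosSet i1 i2 j1 j2) (ht : t ∈ PosSet i1 i2 j1 j2) (hst : s ≤ t)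
    (hmid : (s ≤ i2 ∧ i2 ≤ t) ∨ (s ≤ j1 ∧ j1 ≤ t)) (hd : DistinctBtw a i1 i2 j1 j2 s t) :
    LenBtw i1 i2 j1 j2 s t ≤ BLDS a i1 i2 j1 j2 := by
  classical
  rw [BLDS]
  exact Finset.le_sup (f := fun pq : ℕ × ℕ => LenBtw i1 i2 j1 j2 pq.1 pq.2) (b := (s, t))
    (Finset.mem_filter.2 ⟨Finset.mem_product.2 ⟨hs, ht⟩, hst, hmid, hd⟩)

theorem le_BLDS_cross {α : Type*} {a : ℕ → α} {i1 i2 j1 j2 s t : ℕ} (hij : i2 < j1)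
    (hs : i1 ≤ s) (hs' : s ≤ i2) (ht : j1 ≤ t) (ht' : t ≤ j2)
    (hd : DistinctBtw a i1 i2 j1 j2 s t) :
    (i2 - s + 1) + (t - j1 + 1) ≤ BLDS a i1 i2 j1 j2 := by
  rw [← lenBtw_cross hij hs hs' ht ht']
  exact lenBtw_le_BLDS (mem_PosSet.2 (by omega)) (mem_PosSet.2 (by omega)) (by omega)
    (by omega) hd

theorem le_BLDS_left {α : Type*} {a : ℕ → α} {i1 i2 j1 j2 s : ℕ}
    (hs : i1 ≤ s) (hs' : s ≤ i2) (hd : DistinctBtw a i1 i2 j1 j2 s i2) :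
    i2 - s + 1 ≤ BLDS a i1 i2 j1 j2 := by
  rw [← lenBtw_left (j1 := j1) (j2 := j2) hs hs' le_rfl]
  exact lenBtw_le_BLDS (mem_PosSet.2 (by omega)) (mem_PosSet.2 (by omega)) (by omega)
    (by omega) hd

theorem le_BLDS_right {α : Type*} {a : ℕ → α} {i1 i2 j1 j2 t : ℕ}
    (ht : j1 ≤ t) (ht' : t ≤ j2) (hd : DistinctBtw a i1 i2 j1 j2 j1 t) :
    t - j1 + 1 ≤ BLDS a i1 i2 j1 j2 := by
  rw [← lenBtw_right (i1 := i1) (i2 := i2) le_rfl ht ht']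
  exact lenBtw_le_BLDS (mem_PosSet.2 (by omega)) (mem_PosSet.2 (by omega)) (by omega)
    (by omega) hd

/-- To bound `BLDS` it suffices to consider substrings crossing the boundary, those ending
at `i2` and those starting at `j1`. -/
theorem BLDS_le {α : Type*} {a : ℕ → α} {i1 i2 j1 j2 m : ℕ} (hij : i2 < j1)
    (hcross : ∀ s t, i1 ≤ s → s ≤ i2 → j1 ≤ t → t ≤ j2 → DistinctBtw a i1 i2 j1 j2 s t →
      (i2 - s + 1) + (t - j1 + 1) ≤ m)
    (hleft : ∀ s, i1 ≤ s → s ≤ i2 → DistinctBtw a i1 i2 j1 j2 s i2 → i2 - s + 1 ≤ m)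
    (hright : ∀ t, j1 ≤ t → t ≤ j2 → DistinctBtw a i1 i2 j1 j2 j1 t → t - j1 + 1 ≤ m) :
    BLDS a i1 i2 j1 j2 ≤ m := by
  classical
  rw [BLDS]
  refine Finset.sup_le ?_
  rintro ⟨s, t⟩ hst
  simp only [Finset.mem_filter, Finset.mem_product, mem_PosSet] at hst
  obtain ⟨⟨hs, ht⟩, hle, hmid, hd⟩ := hst
  dsimp only
  by_cases hsi : s ≤ i2
  · by_cases htj : j1 ≤ t
    · rw [lenBtw_cross hij (by omega) hsi htj (by omega)]
      exact hcross s t (by omega) hsi htj (by omega) hd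
    · obtain rfl : t = i2 := by omega
      rw [lenBtw_left (by omega) hle le_rfl]
      exact hleft s (by omega) hsi hd
  · obtain rfl : s = j1 := by omega
    rw [lenBtw_right le_rfl hle (by omega)]
    exact hright t hle (by omega) hd

theorem Lfun_spec {α : Type*} {a : ℕ → α} {i1 i2 j1 j2 s k : ℕ}
    (hs : s ∈ PosSet i1 i2 j1 j2) (hsk : s ≤ k) (hd : DistinctBtw a i1 i2 j1 j2 s k) :
    Lfun a i1 i2 j1 j2 k ∈ PosSet i1 i2 j1 j2 ∧ Lfun a i1 i2 j1 j2 k ≤ k ∧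
      DistinctBtw a i1 i2 j1 j2 (Lfun a i1 i2 j1 j2 k) k :=
  Nat.sInf_mem (s := {p : ℕ | p ∈ PosSet i1 i2 j1 j2 ∧ p ≤ k ∧ DistinctBtw a i1 i2 j1 j2 p k})
    ⟨s, hs, hsk, hd⟩

theorem Lfun_le {α : Type*} {a : ℕ → α} {i1 i2 j1 j2 s k : ℕ}
    (hs : s ∈ PosSet i1 i2 j1 j2) (hsk : s ≤ k) (hd : DistinctBtw a i1 i2 j1 j2 s k) :
    Lfun a i1 i2 j1 j2 k ≤ s :=
  Nat.sInf_le ⟨hs, hsk, hd⟩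

theorem bddAbove_Rfun {α : Type*} (a : ℕ → α) (i1 i2 j1 j2 k : ℕ) :
    BddAbove {q : ℕ | q ∈ PosSet i1 i2 j1 j2 ∧ k ≤ q ∧ DistinctBtw a i1 i2 j1 j2 k q} :=
  (PosSet i1 i2 j1 j2).bddAbove.mono fun _ hq => hq.1

theorem le_Rfun {α : Type*} {a : ℕ → α} {i1 i2 j1 j2 k t : ℕ}
    (ht : t ∈ PosSet i1 i2 j1 j2) (hkt : k ≤ t) (hd : DistinctBtw a i1 i2 j1 j2 k t) :
    t ≤ Rfun a i1 i2 j1 j2 k :=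
  le_csSup (bddAbove_Rfun a i1 i2 j1 j2 k) ⟨ht, hkt, hd⟩

theorem distinctBtw_Rfun {α : Type*} {a : ℕ → α} {i1 i2 j1 j2 k : ℕ}
    (hk : k ∈ PosSet i1 i2 j1 j2) :
    DistinctBtw a i1 i2 j1 j2 k (Rfun a i1 i2 j1 j2 k) := by
  have hne : {q : ℕ | q ∈ PosSet i1 i2 j1 j2 ∧ k ≤ q ∧
      DistinctBtw a i1 i2 j1 j2 k q}.Nonempty :=
    ⟨k, hk, le_rfl, distinctBtw_iff.2 fun u v _ _ hu huv hv => by omega⟩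
  exact (Nat.sSup_mem hne (bddAbove_Rfun a i1 i2 j1 j2 k)).2.2

/-- The value contributed by a reduced description is attained in `b`. -/
theorem reduced_le_BLDS {α : Type*} {a : ℕ → α} {i1 i2 j1 j2 p q x y' : ℕ}
    (hij : i2 < j1) (hp : i1 ≤ p) (hpq : p ≤ q) (hq : q ≤ i2)
    (hx : j1 ≤ x) (hxy' : x ≤ y') (hy' : y' ≤ j2)
    (hl : DistinctBtw a i1 i2 j1 j2 p (prevP i2 j1 x))
    (hr : DistinctBtw a i1 i2 j1 j2 (succP i2 j1 q) y') :
    (i2 - q) + (x - j1) + BLDS a p q x y' ≤ BLDS a i1 i2 j1 j2 := by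
  have hl' := distinctBtw_iff.1 hl
  have hr' := distinctBtw_iff.1 hr
  have hprev : x = j1 ∧ prevP i2 j1 x = i2 ∨ j1 < x ∧ prevP i2 j1 x = x - 1 := by
    unfold prevP; split_ifs <;> omega
  have hsucc : q = i2 ∧ succP i2 j1 q = j1 ∨ q < i2 ∧ succP i2 j1 q = q + 1 := by
    unfold succP; split_ifs <;> omega
  have key : ∀ s, p ≤ s → s ≤ q → DistinctBtw a p q x y' s q →
      (i2 - q) + (x - j1) + (q - s + 1) ≤ BLDS a i1 i2 j1 j2 := by
    intro s hs hsq hd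
    rcases hprev with ⟨hx1, hx2⟩ | ⟨hx1, hx2⟩
    · have := le_BLDS_left (hp.trans hs) (hsq.trans hq)
        (hl.mono hs (by omega))
      omega
    · have := le_BLDS_cross hij (hp.trans hs) (hsq.trans hq) (t := x - 1) (by omega) (by omega)
        (hl.mono hs (by omega))
      omega
  suffices hb : BLDS a p q x y' ≤ BLDS a i1 i2 j1 j2 - ((i2 - q) + (x - j1)) by
    have := key q hpq le_rfl (distinctBtw_iff.2 fun u v _ _ hu huv hv => by omega)
    omega
  refine BLDS_le (by omega) ?_ ?_ ?_
  · intro s t hs hsq hxt hty hd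
    have hd' := distinctBtw_iff.1 hd
    have := le_BLDS_cross hij (a := a) (j2 := j2) (hp.trans hs) (hsq.trans hq) (hx.trans hxt)
      (hty.trans hy') (distinctBtw_iff.2 ?_)
    · omega
    · intro u v hu hv hsu huv hvt
      by_cases hvx : v ≤ prevP i2 j1 x
      · exact hl' u v hu hv (by omega) huv hvx
      by_cases huq : succP i2 j1 q ≤ u
      · exact hr' u v hu hv huq huv (by omega)
      · exact hd' u v (by omega) (by omega) hsu huv hvt
  · intro s hs hsq hd
    have := key s hs hsq hd
    omega
  · intro t hxt hty hd
    rcases hsucc with ⟨hq1, hq2⟩ | ⟨hq1, hq2⟩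
    · have := le_BLDS_right (hx.trans hxt) (hty.trans hy') (hr.mono (by omega) hty)
      omega
    · have := le_BLDS_cross hij (s := q + 1) (by omega) (by omega) (hx.trans hxt)
        (hty.trans hy') (hr.mono (by omega) hty)
      omega

/-- A distinct substring of `b` ending in `[x, y]` is no longer than the value contributed by
the corresponding reduced description. -/
theorem cross_le_reduced {α : Type*} {a : ℕ → α} {i1 i2 j1 j2 p q x y y' s t : ℕ}
    (hij : i2 < j1) (hp : i1 ≤ p) (hx : j1 ≤ x) (hy : y ≤ j2)
    (hpL : p = Lfun a i1 i2 j1 j2 (prevP i2 j1 x))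
    (hq : q = min i2 (p + (y - x + 1) - 1))
    (hy' : y' = min y (Rfun a i1 i2 j1 j2 (succP i2 j1 q)))
    (hl : DistinctBtw a i1 i2 j1 j2 p (prevP i2 j1 x))
    (hs : i1 ≤ s) (hsi : s ≤ i2) (hxt : x ≤ t) (hty : t ≤ y)
    (hd : DistinctBtw a i1 i2 j1 j2 s t) :
    (i2 - s + 1) + (t - j1 + 1) ≤ (i2 - q) + (x - j1) + BLDS a p q x y' := by
  have hprev : x = j1 ∧ prevP i2 j1 x = i2 ∨ j1 < x ∧ prevP i2 j1 x = x - 1 := by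
    unfold prevP; split_ifs <;> omega
  have hsucc : q = i2 ∧ succP i2 j1 q = j1 ∨ q < i2 ∧ succP i2 j1 q = q + 1 := by
    unfold succP; split_ifs <;> omega
  have hps : p ≤ s := hpL ▸ Lfun_le (mem_PosSet.2 (by omega)) (by omega)
    (hd.mono le_rfl (by omega))
  by_cases hsq : s ≤ q
  · have htR := le_Rfun (mem_PosSet.2 (by omega)) (by omega)
      (hd.mono (s' := succP i2 j1 q) (t' := t) (by omega) le_rfl)
    have hd' := distinctBtw_iff.1 hd
    have := le_BLDS_cross (a := a) (j2 := y') (show q < x by omega) hps hsq hxt (by omega)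
      (distinctBtw_iff.2 fun u v _ _ hu huv hv => hd' u v (by omega) (by omega) hu huv hv)
    omega
  · have hl' := distinctBtw_iff.1 hl
    have := le_BLDS_left (a := a) (i2 := q) (j1 := x) (j2 := y') le_rfl (by omega)
      (distinctBtw_iff.2 fun u v _ _ hu huv hv =>
        hl' u v (by omega) (by omega) hu huv (by omega))
    omega

theorem consecutive_intervals {h : ℕ} {x y : ℕ → ℕ} (hne : ∀ ℓ < h, x ℓ ≤ y ℓ)
    (hcons : ∀ ℓ, ℓ + 1 < h → x (ℓ + 1) = y ℓ + 1) (n : ℕ) (hn : n < h) :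
    x 0 ≤ x n ∧ (∀ ℓ ≤ n, y ℓ ≤ y n) ∧ ∀ t, x 0 ≤ t → t ≤ y n → ∃ ℓ ≤ n, x ℓ ≤ t ∧ t ≤ y ℓ := by
  induction n with
  | zero => exact ⟨le_rfl, fun ℓ hℓ => by simp [Nat.le_zero.1 hℓ],
      fun t h1 h2 => ⟨0, le_rfl, h1, h2⟩⟩
  | succ n ih =>
    obtain ⟨hx, hy, hcov⟩ := ih (by omega)
    have hxn := hcons n hn
    have h1 := hne n (by omega)
    have h2 := hne (n + 1) hn
    refine ⟨by omega, fun ℓ hℓ => ?_, fun t h3 h4 => ?_⟩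
    · rcases Nat.le_succ_iff.1 hℓ with hle | rfl
      · have := hy ℓ hle
        omega
      · exact le_rfl
    · by_cases htn : t ≤ y n
      · obtain ⟨ℓ, hℓ, ht⟩ := hcov t h3 htn
        exact ⟨ℓ, by omega, ht⟩
      · exact ⟨n + 1, le_rfl, by omega, h4⟩

theorem stmt2 {α : Type*} (a : ℕ → α) (N i1 i2 j1 j2 : ℕ) (h : ℕ) (x y : ℕ → ℕ)
    (p q y' : ℕ → ℕ)
    (hi1 : 1 ≤ i1) (hi12 : i1 ≤ i2) (hij : i2 < j1) (hj12 : j1 ≤ j2) (hj2N : j2 ≤ N)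
    (hdist : DistinctBtw a i1 i2 j1 j2 i2 j2)
    (hpos : 1 ≤ h)
    -- `J_0, …, J_{h-1}` is a partition of `{j1,…,j2}` into nonempty consecutive
    -- intervals, where `J_ℓ` has left endpoint `x ℓ` and right endpoint `y ℓ`:
    (hx0 : x 0 = j1) (hyend : y (h - 1) = j2)
    (hne : ∀ ℓ < h, x ℓ ≤ y ℓ)
    (hcons : ∀ ℓ, ℓ + 1 < h → x (ℓ + 1) = y ℓ + 1)
    (hp : ∀ ℓ < h, p ℓ = Lfun a i1 i2 j1 j2 (prevP i2 j1 (x ℓ)))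
    (hq : ∀ ℓ < h, q ℓ = min i2 (p ℓ + (y ℓ - x ℓ + 1) - 1))
    (hy' : ∀ ℓ < h, y' ℓ = min (y ℓ) (Rfun a i1 i2 j1 j2 (succP i2 j1 (q ℓ))))
    (hxy' : ∀ ℓ < h, x ℓ ≤ y' ℓ) :
    BLDS a i1 i2 j1 j2 =
      (Finset.range h).sup
        (fun ℓ => (i2 - q ℓ) + (x ℓ - j1) + BLDS a (p ℓ) (q ℓ) (x ℓ) (y' ℓ)) := by
  have hx : ∀ ℓ < h, j1 ≤ x ℓ := fun ℓ hℓ =>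
    hx0 ▸ (consecutive_intervals hne hcons ℓ hℓ).1
  obtain ⟨-, hyle, hcov⟩ := consecutive_intervals hne hcons (h - 1) (by omega)
  rw [hyend] at hyle hcov
  have hL : ∀ ℓ < h, i1 ≤ p ℓ ∧ p ℓ ≤ i2 ∧
      DistinctBtw a i1 i2 j1 j2 (p ℓ) (prevP i2 j1 (x ℓ)) := by
    intro ℓ hℓ
    have := hx ℓ hℓ
    have := hne ℓ hℓ
    have := hyle ℓ (by omega)
    have hprev : i2 ≤ prevP i2 j1 (x ℓ) ∧ prevP i2 j1 (x ℓ) ≤ j2 := by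
      unfold prevP; split_ifs <;> omega
    have hd := hdist.mono le_rfl hprev.2
    have hmem : i2 ∈ PosSet i1 i2 j1 j2 := mem_PosSet.2 (by omega)
    have hspec := Lfun_spec hmem hprev.1 hd
    have hle := Lfun_le hmem hprev.1 hd
    rw [← hp ℓ hℓ] at hspec hle
    have := mem_PosSet.1 hspec.1
    exact ⟨by omega, hle, hspec.2.2⟩
  have hcross : ∀ s t, i1 ≤ s → s ≤ i2 → j1 ≤ t → t ≤ j2 → DistinctBtw a i1 i2 j1 j2 s t →
      (i2 - s + 1) + (t - j1 + 1) ≤ (Finset.range h).sup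
        (fun ℓ => (i2 - q ℓ) + (x ℓ - j1) + BLDS a (p ℓ) (q ℓ) (x ℓ) (y' ℓ)) := by
    intro s t hs hsi ht htj hd
    obtain ⟨ℓ, hℓ, hxt, hty⟩ := hcov t (by omega) htj
    have hℓh : ℓ < h := by omega
    obtain ⟨h1, h2, h3⟩ := hL ℓ hℓh
    exact (cross_le_reduced hij h1 (hx ℓ hℓh) (hyle ℓ hℓ) (hp ℓ hℓh) (hq ℓ hℓh) (hy' ℓ hℓh)
      h3 hs hsi hxt hty hd).trans
      (Finset.le_sup (f := fun ℓ => (i2 - q ℓ) + (x ℓ - j1) + BLDS a (p ℓ) (q ℓ) (x ℓ) (y' ℓ))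
        (Finset.mem_range.2 hℓh))
  apply le_antisymm
  · refine BLDS_le hij hcross ?_ ?_
    · intro s hs hsi hd
      refine le_trans ?_ (Finset.le_sup
        (f := fun ℓ => (i2 - q ℓ) + (x ℓ - j1) + BLDS a (p ℓ) (q ℓ) (x ℓ) (y' ℓ))
        (Finset.mem_range.2 hpos))
      obtain ⟨h1, h2, h3⟩ := hL 0 hpos
      have hprev : prevP i2 j1 (x 0) = i2 := by simp [prevP, hx0]
      have hps : p 0 ≤ s := by
        rw [hp 0 hpos, hprev]
        exact Lfun_le (mem_PosSet.2 (by omega)) hsi hd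
      have hq0 := hq 0 hpos
      have h3' := distinctBtw_iff.1 h3
      have := le_BLDS_left (a := a) (i2 := q 0) (j1 := x 0) (j2 := y' 0) le_rfl (by omega)
        (distinctBtw_iff.2 fun u v _ _ hu huv hv =>
          h3' u v (by omega) (by omega) hu huv (by omega))
      omega
    · intro t ht htj _
      have := hcross i2 t hi12 le_rfl ht htj (hdist.mono le_rfl htj)
      omega
  · refine Finset.sup_le fun ℓ hℓ => ?_
    rw [Finset.mem_range] at hℓ
    obtain ⟨h1, h2, h3⟩ := hL ℓ hℓ
    have hqℓ := hq ℓ hℓ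
    have hy'ℓ := hy' ℓ hℓ
    have := hyle ℓ (by omega)
    have hmem : succP i2 j1 (q ℓ) ∈ PosSet i1 i2 j1 j2 := by
      rw [mem_PosSet]
      unfold succP; split_ifs <;> omega
    exact reduced_le_BLDS hij h1 (by omega) (by omega) (hx ℓ hℓ) (hxy' ℓ hℓ) (by omega) h3
      ((distinctBtw_Rfun hmem).mono le_rfl (by omega))
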